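/- (Schofield) Let f : R → σ⁻¹R be a universally σ-inverting ring homomorphism and write S = σ⁻¹R. Then: (a) the multiplication map S ⊗_R S → S, s ⊗ s' ↦ s·s' (the left factor regarded as a right R-module and the right factor as a left R-module via f), is bijective; and (b) Tor_1^R(S, S) = 0. -/

import Mathlib

open MulOpposite

universe u

section BTensorCore

variable (R : Type u) [Ring R]
variable (M : Type u) [AddCommGroup M] [Module Rᵐᵒᵖ M]
variable (N : Type u) [AddCommGroup N] [Module R N]

/-- The subgroup of relations defining the balanced tensor product `M ⊗_R N`. -/
noncomputable def btRel : AddSubgroup (TensorProduct ℤ M N) :=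
  AddSubgroup.closure
    { x | ∃ (m : M) (r : R) (n : N), x = (op r • m) ⊗ₜ[ℤ] n - m ⊗ₜ[ℤ] (r • n) }

/-- The balanced tensor product `M ⊗_R N` of a right `R`-module `M` and a left `R`-module `N`:
the quotient of `M ⊗_ℤ N` by the relations `(m · r) ⊗ n = m ⊗ (r · n)`. -/
abbrev BTensor : Type u := TensorProduct ℤ M N ⧸ btRel R M N

variable {R M N}

/-- The image of `m ⊗ n` in `M ⊗_R N`. -/
noncomputable def BTensor.tmul (m : M) (n : N) : BTensor R M N :=
  QuotientAddGroup.mk (m ⊗ₜ[ℤ] n)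

variable {A : Type u} [AddCommGroup A]

/-- Lift a balanced biadditive map `M → N → A` to `M ⊗_R N → A`. -/
noncomputable def BTensor.lift (b : M →+ N →+ A)
    (hb : ∀ (r : R) (m : M) (n : N), b (op r • m) n = b m (r • n)) :
    BTensor R M N →+ A :=
  QuotientAddGroup.lift (btRel R M N)
    (TensorProduct.liftAddHom b (fun z m n => by
      simp [map_zsmul]))
    ((AddSubgroup.closure_le _).mpr (by
      rintro y ⟨m, r, n, rfl⟩
      simp [AddMonoidHom.mem_ker, hb r m n]))

/-- Lift a balanced biadditive map given as a bare function. -/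
noncomputable def BTensor.lift' (b : M → N → A)
    (h1 : ∀ m m' n, b (m + m') n = b m n + b m' n)
    (h2 : ∀ m n n', b m (n + n') = b m n + b m n')
    (hb : ∀ (r : R) m n, b (op r • m) n = b m (r • n)) :
    BTensor R M N →+ A :=
  BTensor.lift (AddMonoidHom.mk' (fun m => AddMonoidHom.mk' (b m) (h2 m))
    (fun m m' => AddMonoidHom.ext fun n => h1 m m' n)) hb

section MapRight

variable {N' : Type u} [AddCommGroup N'] [Module R N']

/-- The map `1 ⊗ g : M ⊗_R N → M ⊗_R N'` induced by a map `g` of left `R`-modules. -/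
noncomputable def BTensor.mapRight (g : N →ₗ[R] N') : BTensor R M N →+ BTensor R M N' :=
  QuotientAddGroup.map _ _
    (TensorProduct.map (LinearMap.id (R := ℤ) (M := M)) g.toAddMonoidHom.toIntLinearMap).toAddMonoidHom
    ((AddSubgroup.closure_le _).mpr (by
      rintro y ⟨m, r, n, rfl⟩
      refine AddSubgroup.mem_comap.mpr (AddSubgroup.subset_closure ?_)
      exact ⟨m, r, g n, by simp⟩))

end MapRight

section MapLeft

variable {M' : Type u} [AddCommGroup M'] [Module Rᵐᵒᵖ M']

/-- The map `g ⊗ 1 : M ⊗_R N → M' ⊗_R N` induced by a map `g` of right `R`-modules. -/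
noncomputable def BTensor.mapLeft (g : M →ₗ[Rᵐᵒᵖ] M') : BTensor R M N →+ BTensor R M' N :=
  QuotientAddGroup.map _ _
    (TensorProduct.map g.toAddMonoidHom.toIntLinearMap (LinearMap.id (R := ℤ) (M := N))).toAddMonoidHom
    ((AddSubgroup.closure_le _).mpr (by
      rintro y ⟨m, r, n, rfl⟩
      refine AddSubgroup.mem_comap.mpr (AddSubgroup.subset_closure ?_)
      exact ⟨g m, r, n, by simp⟩))

end MapLeft

end BTensorCore
section Localization

variable {R : Type u} [Ring R] {ι : Type u}
  {P Q : ι → Type u}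
  [∀ i, AddCommGroup (P i)] [∀ i, Module R (P i)]
  [∀ i, AddCommGroup (Q i)] [∀ i, Module R (Q i)]

/-- A ring homomorphism `f : R → S`, together with a right `R`-module structure on `S`, is
`σ`-inverting if the right `R`-action on `S` is the one induced by `f` (i.e. `x • r = x * f r`)
and, for every `s i : P i → Q i` in `σ`, the induced map
`1 ⊗ s i : S ⊗_R P i → S ⊗_R Q i` is bijective. -/
def IsInvertingHom (s : ∀ i, P i →ₗ[R] Q i) (S : Type u) [Ring S] [Module Rᵐᵒᵖ S]
    (f : R →+* S) : Prop :=
  (∀ (r : R) (x : S), op r • x = x * f r) ∧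
    ∀ i, Function.Bijective (BTensor.mapRight (M := S) (s i))

/-- `f : R → S` is universally `σ`-inverting if it is `σ`-inverting and every `σ`-inverting
ring homomorphism `g : R → T` factors through `f` by a unique ring homomorphism `S → T`. -/
def IsUniversalInverting (s : ∀ i, P i →ₗ[R] Q i) (S : Type u) [Ring S] [Module Rᵐᵒᵖ S]
    (f : R →+* S) : Prop :=
  IsInvertingHom s S f ∧
    ∀ (T : Type u) (_ : Ring T) (_ : Module Rᵐᵒᵖ T) (g : R →+* T),
      IsInvertingHom s T g → ∃! h : S →+* T, g = h.comp f

/-- `Tor_1^R(M, N) = 0`: for every short exact sequence `0 → K → F → M → 0` of right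
`R`-modules with `F` projective, the induced map `K ⊗_R N → F ⊗_R N` is injective. -/
def Tor1Vanishes (R : Type u) [Ring R] (M : Type u) [AddCommGroup M] [Module Rᵐᵒᵖ M]
    (N : Type u) [AddCommGroup N] [Module R N] : Prop :=
  ∀ (K F : Type u) (_ : AddCommGroup K) (_ : Module Rᵐᵒᵖ K)
    (_ : AddCommGroup F) (_ : Module Rᵐᵒᵖ F)
    (i : K →ₗ[Rᵐᵒᵖ] F) (p : F →ₗ[Rᵐᵒᵖ] M),
    Module.Projective Rᵐᵒᵖ F → Function.Injective i → Function.Surjective p →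
    (∀ x, p x = 0 ↔ x ∈ Set.range i) →
    Function.Injective (BTensor.mapLeft (N := N) i)

end Localization

namespace BTensor

variable {R : Type u} [Ring R]
variable {M : Type u} [AddCommGroup M] [Module Rᵐᵒᵖ M]
variable {M' : Type u} [AddCommGroup M'] [Module Rᵐᵒᵖ M']
variable {N : Type u} [AddCommGroup N] [Module R N]
variable {N' : Type u} [AddCommGroup N'] [Module R N']
variable {A : Type u} [AddCommGroup A]

theorem add_tmul (m m' : M) (n : N) :
    tmul (R := R) (m + m') n = tmul m n + tmul m' n :=
  congrArg (QuotientAddGroup.mk (s := btRel R M N)) (TensorProduct.add_tmul m m' n)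

theorem tmul_add (m : M) (n n' : N) :
    tmul (R := R) m (n + n') = tmul m n + tmul m n' :=
  congrArg (QuotientAddGroup.mk (s := btRel R M N)) (TensorProduct.tmul_add m n n')

theorem smul_tmul (r : R) (m : M) (n : N) :
    tmul (R := R) (op r • m) n = tmul m (r • n) := by
  refine (QuotientAddGroup.eq_iff_sub_mem (N := btRel R M N)).mpr ?_
  exact AddSubgroup.subset_closure ⟨m, r, n, rfl⟩

/-- The map `m ⊗ n` as a biadditive map. -/
noncomputable def mk : M →+ N →+ BTensor R M N :=
  AddMonoidHom.mk' (fun m => AddMonoidHom.mk' (tmul m) (tmul_add m))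
    fun m m' => AddMonoidHom.ext fun n => add_tmul m m' n

theorem mk_apply (m : M) (n : N) : mk (R := R) m n = tmul m n := rfl

theorem tmul_sum {κ : Type*} (t : Finset κ) (m : M) (n : κ → N) :
    tmul (R := R) m (∑ j ∈ t, n j) = ∑ j ∈ t, tmul m (n j) :=
  map_sum (mk (R := R) m) n t

theorem zero_tmul (n : N) : tmul (R := R) (0 : M) n = 0 := by
  rw [← mk_apply, map_zero, AddMonoidHom.zero_apply]

theorem lift'_tmul (b : M → N → A) (h1 h2 hb) (m : M) (n : N) :
    lift' (R := R) b h1 h2 hb (tmul m n) = b m n := rfl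

theorem mapRight_tmul (g : N →ₗ[R] N') (m : M) (n : N) :
    mapRight g (tmul m n) = tmul m (g n) := rfl

theorem mapLeft_tmul (g : M →ₗ[Rᵐᵒᵖ] M') (m : M) (n : N) :
    mapLeft g (tmul m n) = tmul (g m) n := rfl

@[elab_as_elim]
theorem induction {motive : BTensor R M N → Prop} (zero : motive 0)
    (tmul : ∀ m n, motive (tmul m n)) (add : ∀ x y, motive x → motive y → motive (x + y))
    (x : BTensor R M N) : motive x := by
  obtain ⟨x, rfl⟩ := QuotientAddGroup.mk_surjective x
  induction x using TensorProduct.induction_on with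
  | zero => exact zero
  | tmul m n => exact tmul m n
  | add x y hx hy => exact add _ _ hx hy

theorem hom_ext {g h : BTensor R M N →+ A} (H : ∀ m n, g (tmul m n) = h (tmul m n)) : g = h := by
  refine AddMonoidHom.ext fun x => ?_
  induction x using induction with
  | zero => simp
  | tmul m n => exact H m n
  | add x y hx hy => rw [map_add, map_add, hx, hy]

theorem mapRight_mapLeft (i : M →ₗ[Rᵐᵒᵖ] M') (g : N →ₗ[R] N') (x : BTensor R M N) :
    mapRight g (mapLeft i x) = mapLeft i (mapRight g x) :=
  DFunLike.congr_fun (hom_ext (g := (mapRight g).comp (mapLeft i))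
    (h := (mapLeft i).comp (mapRight g)) fun _ _ => rfl) x

/-- Contraction `M ⊗_R N → M` along a linear form on `N`. -/
noncomputable def contract (φ : N →ₗ[R] R) : BTensor R M N →+ M :=
  lift' (fun m n => op (φ n) • m) (fun _ _ _ => smul_add _ _ _)
    (fun _ _ _ => by rw [map_add, op_add, add_smul])
    (fun _ _ _ => by rw [map_smul, smul_eq_mul, op_mul, mul_smul])

theorem contract_tmul (φ : N →ₗ[R] R) (m : M) (n : N) :
    contract φ (tmul m n) = op (φ n) • m := rfl

theorem contract_mapLeft (i : M →ₗ[Rᵐᵒᵖ] M') (φ : N →ₗ[R] R) (x : BTensor R M N) :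
    contract φ (mapLeft i x) = i (contract φ x) :=
  DFunLike.congr_fun (hom_ext (g := (contract φ).comp (mapLeft i))
    (h := i.toAddMonoidHom.comp (contract φ))
    fun m n => (i.map_smul (op (φ n)) m).symm) x

theorem sum_contract_tmul {κ : Type*} [Fintype κ] {b : κ → N} {φ : κ → N →ₗ[R] R}
    (hb : ∀ n, ∑ j, φ j n • b j = n) (x : BTensor R M N) :
    ∑ j, tmul (contract (φ j) x) (b j) = x := by
  induction x using induction with
  | zero => simp [zero_tmul]
  | tmul m n => simp_rw [contract_tmul, smul_tmul, ← tmul_sum, hb]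
  | add x y hx hy => simp_rw [map_add, add_tmul, Finset.sum_add_distrib, hx, hy]

theorem exists_dual_basis (R N : Type*) [Ring R] [AddCommGroup N] [Module R N]
    [Module.Finite R N] [Module.Projective R N] :
    ∃ (n : ℕ) (b : Fin n → N) (φ : Fin n → N →ₗ[R] R), ∀ x, ∑ j, φ j x • b j = x := by
  obtain ⟨n, g, hg⟩ := Module.Finite.exists_fin' R N
  obtain ⟨l, hl⟩ := Module.projective_lifting_property g LinearMap.id hg
  refine ⟨n, fun j => g (Pi.single j 1), fun j => (LinearMap.proj j).comp l, fun x => ?_⟩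
  conv_rhs => rw [← LinearMap.id_apply (R := R) x, ← hl, LinearMap.comp_apply,
    ← Finset.univ_sum_single (l x), map_sum]
  refine Finset.sum_congr rfl fun j _ => ?_
  rw [← map_smul, ← Pi.single_smul, smul_eq_mul, mul_one]
  rfl

section FiniteProjective

variable [Module.Finite R N] [Module.Projective R N]

theorem mapLeft_injective {i : M →ₗ[Rᵐᵒᵖ] M'} (hi : Function.Injective i) :
    Function.Injective (mapLeft (N := N) i) := by
  obtain ⟨n, b, φ, hb⟩ := exists_dual_basis R N
  refine (injective_iff_map_eq_zero _).mpr fun x hx => ?_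
  rw [← sum_contract_tmul hb x]
  refine Finset.sum_eq_zero fun j _ => ?_
  have hj : contract (φ j) x = 0 :=
    (map_eq_zero_iff i hi).mp (by rw [← contract_mapLeft, hx, map_zero])
  rw [hj, zero_tmul]

theorem mapLeft_surjective {p : M →ₗ[Rᵐᵒᵖ] M'} (hp : Function.Surjective p) :
    Function.Surjective (mapLeft (N := N) p) := by
  obtain ⟨n, b, φ, hb⟩ := exists_dual_basis R N
  intro y
  choose c hc using hp
  refine ⟨∑ j, tmul (c (contract (φ j) y)) (b j), ?_⟩
  simp_rw [map_sum, mapLeft_tmul, hc]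
  exact sum_contract_tmul hb y

theorem exists_mapLeft_eq {M'' : Type u} [AddCommGroup M''] [Module Rᵐᵒᵖ M'']
    {i : M →ₗ[Rᵐᵒᵖ] M'} {p : M' →ₗ[Rᵐᵒᵖ] M''} (h : ∀ x, p x = 0 → ∃ y, i y = x)
    {x : BTensor R M' N} (hx : mapLeft p x = 0) : ∃ y, mapLeft i y = x := by
  obtain ⟨n, b, φ, hb⟩ := exists_dual_basis R N
  choose c hc using fun j => h (contract (φ j) x) (by rw [← contract_mapLeft, hx, map_zero])
  refine ⟨∑ j, tmul (c j) (b j), ?_⟩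
  simp_rw [map_sum, mapLeft_tmul, hc]
  exact sum_contract_tmul hb x

end FiniteProjective

/-- If `M ⊗_R N → M ⊗_R N'` is bijective for the outer terms of a short exact sequence of right
modules, then so is it for the middle term. -/
theorem mapRight_bijective_of_exact {M'' : Type u} [AddCommGroup M''] [Module Rᵐᵒᵖ M'']
    [Module.Finite R N] [Module.Projective R N] [Module.Finite R N'] [Module.Projective R N']
    (g : N →ₗ[R] N') {i : M →ₗ[Rᵐᵒᵖ] M'} {p : M' →ₗ[Rᵐᵒᵖ] M''}
    (hi : Function.Injective i) (hp : Function.Surjective p) (hip : Function.Exact i p)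
    (h : Function.Bijective (mapRight (M := M) g))
    (h'' : Function.Bijective (mapRight (M := M'') g)) :
    Function.Bijective (mapRight (M := M') g) := by
  have hex : ∀ x, p x = 0 → ∃ y, i y = x := fun x => (hip x).mp
  have hcomp : ∀ z : BTensor R M N', mapLeft p (mapLeft i z) = 0 := fun z => by
    induction z using induction with
    | zero => simp
    | tmul m n => rw [mapLeft_tmul, mapLeft_tmul, hip.apply_apply_eq_zero, zero_tmul]
    | add x y hx hy => rw [map_add, map_add, hx, hy, add_zero]
  constructor
  · refine (injective_iff_map_eq_zero _).mpr fun x hx => ?_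
    obtain ⟨z, rfl⟩ := exists_mapLeft_eq (x := x) hex <|
      (map_eq_zero_iff _ h''.1).mp (by rw [mapRight_mapLeft, hx, map_zero])
    rw [mapRight_mapLeft, map_eq_zero_iff _ (mapLeft_injective hi), map_eq_zero_iff _ h.1] at hx
    rw [hx, map_zero]
  · intro y
    obtain ⟨x'', hx''⟩ := h''.2 (mapLeft p y)
    obtain ⟨x, rfl⟩ := mapLeft_surjective hp x''
    obtain ⟨z, hz⟩ := exists_mapLeft_eq (x := y - mapRight g x) hex
      (by rw [map_sub, ← mapRight_mapLeft, hx'', sub_self])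
    obtain ⟨w, rfl⟩ := h.2 z
    exact ⟨mapLeft i w + x, by rw [map_add, mapRight_mapLeft, hz, sub_add_cancel]⟩

section HomModule

variable {X : Type u} [AddCommGroup X] {H : Type u} [AddCommGroup H] [Module Rᵐᵒᵖ H]
  (θ : H ≃+ (X →+ M)) (hθ : ∀ (r : R) h x, θ (op r • h) x = op r • θ h x)

/-- The canonical map `Hom(X, M) ⊗_R N → Hom(X, M ⊗_R N)`, where `Hom(X, M)` is presented as a
right module `H`. -/
noncomputable def homTensor : BTensor R H N →+ (X →+ BTensor R M N) :=
  lift' (fun h n => (mk.flip n).comp (θ h))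
    (fun _ _ _ => by ext; simp [mk_apply]) (fun _ _ _ => by ext; simp [mk_apply])
    (fun r h n => by ext x; simp [mk_apply, hθ, smul_tmul])

theorem homTensor_tmul (h : H) (n : N) (x : X) :
    homTensor θ hθ (tmul h n) x = tmul (θ h x) n := rfl

theorem homTensor_bijective [Module.Finite R N] [Module.Projective R N] :
    Function.Bijective (homTensor (N := N) θ hθ) := by
  obtain ⟨n, b, φ, hb⟩ := exists_dual_basis R N
  refine Function.bijective_iff_has_inverse.mpr
    ⟨fun u => ∑ j, tmul (θ.symm ((contract (φ j)).comp u)) (b j), fun x => ?_, fun u => ?_⟩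
  · have key : ∀ j, (contract (φ j)).comp (homTensor θ hθ x) = θ (contract (φ j) x) := fun j => by
      induction x using induction with
      | zero => ext; simp
      | tmul h n => ext y; simp [homTensor_tmul, contract_tmul, hθ]
      | add x y hx hy => simp [AddMonoidHom.comp_add, hx, hy]
    simp_rw [key, AddEquiv.symm_apply_apply]
    exact sum_contract_tmul hb x
  · ext x
    simp_rw [map_sum, AddMonoidHom.finsetSum_apply, homTensor_tmul, AddEquiv.apply_symm_apply]
    exact sum_contract_tmul hb (u x)

theorem homTensor_mapRight (g : N →ₗ[R] N') (y : BTensor R H N) :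
    homTensor θ hθ (mapRight g y) = (mapRight g).comp (homTensor θ hθ y) := by
  induction y using induction with
  | zero => ext; simp
  | tmul h n => rfl
  | add x y hx hy => simp [AddMonoidHom.comp_add, hx, hy]

theorem mapRight_bijective_of_hom (θ : H ≃+ (X →+ M))
    (hθ : ∀ (r : R) h x, θ (op r • h) x = op r • θ h x)
    [Module.Finite R N] [Module.Projective R N] [Module.Finite R N'] [Module.Projective R N']
    (g : N →ₗ[R] N') (hg : Function.Bijective (mapRight (M := M) g)) :
    Function.Bijective (mapRight (M := H) g) := by
  have hpost : Function.Bijective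
      (fun u : X →+ BTensor R M N => (mapRight g).comp u) := by
    refine ⟨fun u v huv => AddMonoidHom.ext fun x => hg.1 (DFunLike.congr_fun huv x), fun v =>
      ⟨(AddEquiv.ofBijective _ hg).symm.toAddMonoidHom.comp v, AddMonoidHom.ext fun x => ?_⟩⟩
    exact (AddEquiv.ofBijective _ hg).apply_symm_apply (v x)
  have hcomp := hpost.comp (homTensor_bijective (N := N) θ hθ)
  refine (Function.Bijective.of_comp_iff' (homTensor_bijective (N := N') θ hθ) _).mp ?_
  convert hcomp using 1
  exact funext fun y => homTensor_mapRight θ hθ g y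

end HomModule

section RestrictScalars

variable {S : Type u} [Ring S] [Module Rᵐᵒᵖ S] {f : R →+* S}

/-- If `1 ⊗ g : S ⊗_R N → S ⊗_R N'` is bijective, then so is `M ⊗_R N → M ⊗_R N'` for every right
`S`-module `M`. -/
theorem mapRight_bijective_of_module (hright : ∀ (r : R) (x : S), op r • x = x * f r)
    [Module Sᵐᵒᵖ M] (hM : ∀ (r : R) (m : M), op r • m = op (f r) • m)
    (g : N →ₗ[R] N') (hg : Function.Bijective (mapRight (M := S) g)) :
    Function.Bijective (mapRight (M := M) g) := by
  let act (m : M) : S →ₗ[Rᵐᵒᵖ] M :=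
    { toFun := fun x => op x • m
      map_add' := fun x y => by rw [op_add, add_smul]
      map_smul' := fun r x => by
        rw [← op_unop r, hright, op_mul, mul_smul, ← hM, RingHom.id_apply] }
  let lmul (a : S) : S →ₗ[Rᵐᵒᵖ] S :=
    { toFun := fun x => a * x
      map_add' := mul_add a
      map_smul' := fun r x => by rw [RingHom.id_apply, ← op_unop r, hright, hright, mul_assoc] }
  let e := AddEquiv.ofBijective _ hg
  have he : ∀ y, mapRight (M := S) g (e.symm y) = y := e.apply_symm_apply
  have hact_add : ∀ m m' (y : BTensor R S N),
      mapLeft (act (m + m')) y = mapLeft (act m) y + mapLeft (act m') y := fun m m' y => by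
    induction y using induction with
    | zero => simp
    | tmul x n => simp [mapLeft_tmul, act, add_tmul]
    | add x y hx hy => simp only [map_add, hx, hy]; abel
  have hact_smul : ∀ (r : R) m (y : BTensor R S N),
      mapLeft (act (op r • m)) y = mapLeft (act m) (mapLeft (lmul (f r)) y) := fun r m y => by
    induction y using induction with
    | zero => simp
    | tmul x n => simp [mapLeft_tmul, act, lmul, hM, mul_smul]
    | add x y hx hy => simp only [map_add, hx, hy]
  let ψ : BTensor R M N' →+ BTensor R M N :=
    lift' (fun m q => mapLeft (act m) (e.symm (tmul 1 q))) (fun m m' q => hact_add m m' _)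
      (fun m q q' => by simp only [tmul_add, map_add])
      (fun r m q => by
        simp only [hact_smul]
        congr 1
        apply e.injective
        change mapRight g (mapLeft (lmul (f r)) _) = mapRight g _
        rw [mapRight_mapLeft, he, he, ← smul_tmul, mapLeft_tmul, hright]
        simp [lmul])
  have hψ : ∀ m q, ψ (tmul m q) = mapLeft (act m) (e.symm (tmul 1 q)) := fun _ _ => rfl
  refine Function.bijective_iff_has_inverse.mpr ⟨ψ, fun x => ?_, fun y => ?_⟩
  · induction x using induction with
    | zero => simp
    | tmul m n =>
      rw [mapRight_tmul, hψ, ← mapRight_tmul]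
      have he' : e.symm (mapRight g (tmul 1 n)) = tmul 1 n :=
        e.symm_apply_apply (tmul 1 n)
      rw [he', mapLeft_tmul]
      simp [act]
    | add x y hx hy => rw [map_add, map_add, hx, hy]
  · induction y using induction with
    | zero => simp
    | tmul m q => rw [hψ, mapRight_mapLeft, he, mapLeft_tmul]; simp [act]
    | add x y hx hy => rw [map_add, map_add, hx, hy]

end RestrictScalars

end BTensor

section RightModules

variable {R : Type u} [Ring R]

/-- A right module structure on `E` as a ring homomorphism to the opposite endomorphism ring. -/
def rightAction (R E : Type*) [Ring R] [AddCommGroup E] [Module Rᵐᵒᵖ E] :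
    R →+* (AddMonoid.End E)ᵐᵒᵖ where
  toFun r := op (Module.toAddMonoidEnd Rᵐᵒᵖ E (op r))
  map_one' := by simp
  map_mul' a b := by simp
  map_zero' := by simp
  map_add' a b := by simp

theorem unop_rightAction_apply {R E : Type*} [Ring R] [AddCommGroup E] [Module Rᵐᵒᵖ E]
    (r : R) (e : E) : unop (rightAction R E r) e = op r • e := rfl

variable {ι : Type u} {P Q : ι → Type u}
  [∀ i, AddCommGroup (P i)] [∀ i, Module R (P i)]
  [∀ i, AddCommGroup (Q i)] [∀ i, Module R (Q i)]
  {s : ∀ i, P i →ₗ[R] Q i}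
  [∀ i, Module.Finite R (P i)] [∀ i, Module.Projective R (P i)]
  [∀ i, Module.Finite R (Q i)] [∀ i, Module.Projective R (Q i)]
  {S : Type u} [Ring S] [Module Rᵐᵒᵖ S] {f : R →+* S}
  {E : Type u} [AddCommGroup E] [Module Rᵐᵒᵖ E]

/-- The right multiplication structure induced by a ring homomorphism. -/
abbrev rightModuleOfHom {T : Type*} [Ring T] (g : R →+* T) : Module Rᵐᵒᵖ T :=
  Module.compHom T g.op

theorem isInvertingHom_rightAction
    (hE : ∀ i, Function.Bijective (BTensor.mapRight (M := E) (s i))) :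
    @IsInvertingHom R _ ι P Q _ _ _ _ s (AddMonoid.End E)ᵐᵒᵖ _
      (rightModuleOfHom (rightAction R E)) (rightAction R E) := by
  let _ := rightModuleOfHom (rightAction R E)
  refine ⟨fun _ _ => rfl, fun i => ?_⟩
  exact BTensor.mapRight_bijective_of_hom (X := E) (M := E)
    (MulOpposite.opAddEquiv (α := AddMonoid.End E)).symm (fun _ _ _ => rfl) (s i) (hE i)

/-- A right `R`-module inverted by `σ` has exactly one right `S`-module structure extending the
given one. -/
theorem IsUniversalInverting.existsUnique_rightAction (huniv : IsUniversalInverting s S f)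
    (hE : ∀ i, Function.Bijective (BTensor.mapRight (M := E) (s i))) :
    ∃! h : S →+* (AddMonoid.End E)ᵐᵒᵖ, rightAction R E = h.comp f :=
  huniv.2 _ _ (rightModuleOfHom (rightAction R E)) _ (isInvertingHom_rightAction hE)

theorem IsUniversalInverting.exists_module (huniv : IsUniversalInverting s S f)
    (hE : ∀ i, Function.Bijective (BTensor.mapRight (M := E) (s i))) :
    ∃ _ : Module Sᵐᵒᵖ E, ∀ (r : R) (e : E), op r • e = op (f r) • e := by
  obtain ⟨h, hh, -⟩ := huniv.existsUnique_rightAction hE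
  refine ⟨Module.compHom E
    ((RingEquiv.opOp (AddMonoid.End E)).symm.toRingHom.comp h.op), fun r e => ?_⟩
  exact DFunLike.congr_fun (congrArg unop (DFunLike.congr_fun hh r)) e

variable {E' : Type u} [AddCommGroup E'] [Module Rᵐᵒᵖ E'] [Module Sᵐᵒᵖ E'] [Module Sᵐᵒᵖ E]

/-- An `R`-linear map between right `S`-modules is `S`-linear. -/
theorem IsUniversalInverting.map_op_smul (huniv : IsUniversalInverting s S f)
    (hE : ∀ (r : R) (e : E), op r • e = op (f r) • e)
    (hE' : ∀ (r : R) (e : E'), op r • e = op (f r) • e)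
    (φ : E →ₗ[Rᵐᵒᵖ] E') (x : S) (e : E) : φ (op x • e) = op x • φ e := by
  have hprod : ∀ (r : R) (e : E × E'), op r • e = op (f r) • e := fun r e =>
    Prod.ext (hE r e.1) (hE' r e.2)
  have hloc : ∀ i, Function.Bijective (BTensor.mapRight (M := E × E') (s i)) := fun i =>
    BTensor.mapRight_bijective_of_module huniv.1.1 hprod (s i) (huniv.1.2 i)
  let n : AddMonoid.End (E × E') := (AddMonoidHom.inr E E').comp
    (φ.toAddMonoidHom.comp (AddMonoidHom.fst E E'))
  have hn : n * n = 0 := by exact AddMonoidHom.ext fun e => Prod.ext rfl φ.map_zero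
  let u : ((AddMonoid.End (E × E'))ᵐᵒᵖ)ˣ :=
    { val := op (1 + n)
      inv := op (1 - n)
      val_inv := by rw [← op_mul, sub_mul, one_mul, mul_add, hn]; simp
      inv_val := by rw [← op_mul, add_mul, one_mul, mul_sub, hn]; simp }
  let h₁ := rightAction S (E × E')
  let h₂ : S →+* (AddMonoid.End (E × E'))ᵐᵒᵖ :=
    { toFun := fun x => u⁻¹ * h₁ x * u
      map_one' := by simp
      map_mul' := fun a b => by simp [mul_assoc]
      map_zero' := by simp
      map_add' := fun a b => by rw [map_add, mul_add, add_mul] }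
  have hu : ∀ e, unop (u : (AddMonoid.End (E × E'))ᵐᵒᵖ) e = (e.1 + 0, e.2 + φ e.1) := fun _ => rfl
  have hcomm : ∀ r, h₁ (f r) * u = u * h₁ (f r) := fun r => by
    refine unop_injective (AddMonoidHom.ext fun e => ?_)
    change unop (u : (AddMonoid.End (E × E'))ᵐᵒᵖ) (op (f r) • e) = op (f r) • unop u.val e
    rw [← hprod, ← hprod, hu, hu]
    simp
  have hh₁ : rightAction R (E × E') = h₁.comp f :=
    RingHom.ext fun r => unop_injective (AddMonoidHom.ext fun e => hprod r e)
  have hh₂ : rightAction R (E × E') = h₂.comp f := by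
    refine hh₁.trans (RingHom.ext fun r => ?_)
    change h₁ (f r) = u⁻¹ * h₁ (f r) * u
    rw [mul_assoc, hcomm, Units.inv_mul_cancel_left]
  have heq : h₁ x = u⁻¹ * h₁ x * u := DFunLike.congr_fun
    ((huniv.existsUnique_rightAction hloc).unique hh₁ hh₂) x
  rw [mul_assoc, Units.eq_inv_mul_iff_mul_eq] at heq
  have hx : op x • unop u.val (e, (0 : E')) = unop u.val (op x • (e, (0 : E'))) :=
    DFunLike.congr_fun (congrArg unop heq) (e, (0 : E'))
  simpa [hu] using (congrArg Prod.snd hx).symm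

/-- Extensions of `S` by a right `S`-module split over `R`. -/
theorem IsUniversalInverting.exists_retraction (huniv : IsUniversalInverting s S f)
    {N : Type u} [AddCommGroup N] [Module Rᵐᵒᵖ N] [Module Sᵐᵒᵖ N]
    (hN : ∀ (r : R) (n : N), op r • n = op (f r) • n)
    {E : Type u} [AddCommGroup E] [Module Rᵐᵒᵖ E] {j : N →ₗ[Rᵐᵒᵖ] E} {π : E →ₗ[Rᵐᵒᵖ] S}
    (hj : Function.Injective j) (hπ : Function.Surjective π) (hjπ : Function.Exact j π) :
    ∃ l : E →ₗ[Rᵐᵒᵖ] N, l.comp j = LinearMap.id := by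
  have hS : ∀ (r : R) (x : S), op r • x = op (f r) • x := huniv.1.1
  obtain ⟨_, hE⟩ := huniv.exists_module fun i =>
    BTensor.mapRight_bijective_of_exact (s i) hj hπ hjπ
      (BTensor.mapRight_bijective_of_module huniv.1.1 hN (s i) (huniv.1.2 i)) (huniv.1.2 i)
  obtain ⟨e, he⟩ := hπ 1
  let sec : S →ₗ[Rᵐᵒᵖ] E :=
    { toFun := fun x => op x • e
      map_add' := fun x y => by rw [op_add, add_smul]
      map_smul' := fun r x => by
        rw [RingHom.id_apply, ← op_unop r, hE, ← mul_smul, ← op_mul, huniv.1.1] }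
  have hsec : π.comp sec = LinearMap.id := LinearMap.ext fun x => by
    change π (op x • e) = x
    rw [huniv.map_op_smul hE hS, he, op_smul_eq_mul, one_mul]
  have htfae := (hjπ.split_tfae hj hπ).out 0 1
  exact htfae.mp ⟨sec, hsec⟩

/-- Maps to right `S`-modules extend along the kernel of an `R`-linear surjection onto `S`. -/
theorem IsUniversalInverting.exists_extension (huniv : IsUniversalInverting s S f)
    {N : Type u} [AddCommGroup N] [Module Rᵐᵒᵖ N] [Module Sᵐᵒᵖ N]
    (hN : ∀ (r : R) (n : N), op r • n = op (f r) • n)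
    {K F : Type u} [AddCommGroup K] [Module Rᵐᵒᵖ K] [AddCommGroup F] [Module Rᵐᵒᵖ F]
    {i : K →ₗ[Rᵐᵒᵖ] F} {p : F →ₗ[Rᵐᵒᵖ] S}
    (hi : Function.Injective i) (hp : Function.Surjective p) (hip : Function.Exact i p)
    (δ : K →ₗ[Rᵐᵒᵖ] N) : ∃ ρ : F →ₗ[Rᵐᵒᵖ] N, ∀ k, ρ (i k) = δ k := by
  let W : Submodule Rᵐᵒᵖ (N × F) := LinearMap.range ((-δ).prod i)
  have hW : ∀ n x, (n, x) ∈ W ↔ ∃ k, -δ k = n ∧ i k = x := fun n x => by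
    simp [W, LinearMap.mem_range]
  let j : N →ₗ[Rᵐᵒᵖ] (N × F) ⧸ W := W.mkQ.comp (LinearMap.inl Rᵐᵒᵖ N F)
  let π : ((N × F) ⧸ W) →ₗ[Rᵐᵒᵖ] S := W.liftQ (p.comp (LinearMap.snd Rᵐᵒᵖ N F)) <| by
    rintro _ ⟨k, rfl⟩
    exact hip.apply_apply_eq_zero k
  have hj : Function.Injective j := (injective_iff_map_eq_zero _).mpr fun n hn => by
    obtain ⟨k, rfl, hk⟩ := (hW n 0).mp ((Submodule.Quotient.mk_eq_zero W).mp hn)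
    rw [(map_eq_zero_iff i hi).mp hk, map_zero, neg_zero]
  have hπ : Function.Surjective π := fun y => by
    obtain ⟨x, rfl⟩ := hp y
    exact ⟨W.mkQ (0, x), rfl⟩
  have hrel : ∀ k, j (δ k) = W.mkQ (0, i k) := fun k => by
    refine (Submodule.Quotient.eq W).mpr ?_
    exact (hW _ _).mpr ⟨-k, by simp, by simp⟩
  have hjπ : Function.Exact j π := fun e => by
    constructor
    · obtain ⟨⟨n, x⟩, rfl⟩ := W.mkQ_surjective e
      intro hx
      obtain ⟨k, rfl⟩ := (hip x).mp hx
      refine ⟨n + δ k, ?_⟩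
      rw [map_add, hrel]
      change W.mkQ (n, 0) + W.mkQ (0, i k) = _
      rw [← map_add, Prod.mk_add_mk, add_zero, zero_add]
    · rintro ⟨n, rfl⟩
      exact p.map_zero
  obtain ⟨l, hl⟩ := huniv.exists_retraction hN hj hπ hjπ
  refine ⟨l.comp (W.mkQ.comp (LinearMap.inr Rᵐᵒᵖ N F)), fun k => ?_⟩
  change l (W.mkQ (0, i k)) = _
  rw [← hrel]
  exact DFunLike.congr_fun hl (δ k)

end RightModules

namespace BTensor

variable {R : Type u} [Ring R] {S : Type u} [Ring S] [Module R S] {f : R →+* S}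
variable {M : Type u} [AddCommGroup M] [Module Rᵐᵒᵖ M]

/-- The right `S`-module structure on `M ⊗_R S` given by multiplication on the right factor. -/
noncomputable abbrev rightModule (hleft : ∀ (r : R) (x : S), r • x = f r * x) :
    Module Sᵐᵒᵖ (BTensor R M S) :=
  let rmul (t : S) : S →ₗ[R] S :=
    { toFun := fun x => x * t
      map_add' := fun x y => add_mul x y t
      map_smul' := fun r x => by rw [hleft, hleft, mul_assoc, RingHom.id_apply] }
  { smul := fun t x => mapRight (rmul (unop t)) x
    one_smul := DFunLike.congr_fun <| hom_ext (g := mapRight (rmul 1)) (h := AddMonoidHom.id _)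
      fun m x => congrArg (tmul m) (mul_one x)
    mul_smul := fun t u => DFunLike.congr_fun <|
      hom_ext (g := mapRight (rmul (unop u * unop t)))
        (h := (mapRight (rmul (unop t))).comp (mapRight (rmul (unop u))))
        fun m x => congrArg (tmul m) (mul_assoc x (unop u) (unop t)).symm
    smul_zero := fun t => map_zero (mapRight (rmul (unop t)))
    smul_add := fun t => map_add (mapRight (rmul (unop t)))
    add_smul := fun t u => DFunLike.congr_fun <|
      hom_ext (g := mapRight (rmul (unop t + unop u)))
        (h := mapRight (rmul (unop t)) + mapRight (rmul (unop u)))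
        fun m x => (congrArg (tmul m) (mul_add x (unop t) (unop u))).trans (tmul_add m _ _)
    zero_smul := DFunLike.congr_fun <| hom_ext (g := mapRight (rmul 0)) (h := 0)
      fun m x => (congrArg (tmul m) (mul_zero x)).trans (map_zero (mk m)) }

/-- The map `m ↦ m ⊗ 1` as a map of right `R`-modules. -/
noncomputable def tmulOne [Module Rᵐᵒᵖ (BTensor R M S)] [Module Sᵐᵒᵖ (BTensor R M S)]
    (hleft : ∀ (r : R) (x : S), r • x = f r * x)
    (hsmul : ∀ (m : M) (x y : S), op y • tmul (R := R) m x = tmul m (x * y))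
    (hcompat : ∀ (r : R) (z : BTensor R M S), op r • z = op (f r) • z) :
    M →ₗ[Rᵐᵒᵖ] BTensor R M S where
  toFun m := tmul m 1
  map_add' m m' := add_tmul m m' 1
  map_smul' r m := by
    rw [RingHom.id_apply, ← op_unop r, hcompat, hsmul, smul_tmul, hleft, mul_one, one_mul]

end BTensor

section Localization

variable {R : Type u} [Ring R] {ι : Type u}
  {P Q : ι → Type u}
  [∀ i, AddCommGroup (P i)] [∀ i, Module R (P i)]
  [∀ i, AddCommGroup (Q i)] [∀ i, Module R (Q i)]

/-- **Schofield's theorem**: if `f : R → S = σ⁻¹R` is a universally `σ`-inverting ring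
homomorphism, then (a) the multiplication map `S ⊗_R S → S` is bijective, and
(b) `Tor_1^R(S, S) = 0`. -/
theorem bijective_mul_and_tor1_eq_zero_of_universal_inverting
    (s : ∀ i, P i →ₗ[R] Q i)
    (hPfin : ∀ i, Module.Finite R (P i)) (hPproj : ∀ i, Module.Projective R (P i))
    (hQfin : ∀ i, Module.Finite R (Q i)) (hQproj : ∀ i, Module.Projective R (Q i))
    (S : Type u) [Ring S] [Module Rᵐᵒᵖ S] [Module R S] (f : R →+* S)
    (hright : ∀ (r : R) (x : S), op r • x = x * f r)
    (hleft : ∀ (r : R) (x : S), r • x = f r * x)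
    (huniv : IsUniversalInverting s S f) :
    Function.Bijective (BTensor.lift' (R := R) (M := S) (N := S) (fun x y => x * y)
      (fun x x' y => add_mul x x' y) (fun x y y' => mul_add x y y')
      (fun r x y => by simp only [hright, hleft, mul_assoc])) ∧
    Tor1Vanishes R S S := by
  constructor
  · let _ : Module Sᵐᵒᵖ (BTensor R S S) := BTensor.rightModule hleft
    let _ : Module Rᵐᵒᵖ (BTensor R S S) := Module.compHom _ f.op
    have key : ∀ x : S, BTensor.tmul (R := R) x (1 : S) = BTensor.tmul 1 x := fun x => by
      have h := huniv.map_op_smul (E := S) hright (fun _ _ => rfl)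
        (BTensor.tmulOne hleft (fun _ _ _ => rfl) (fun _ _ => rfl)) x 1
      rw [op_smul_eq_mul, one_mul] at h
      exact h.trans (congrArg (BTensor.tmul (1 : S)) (one_mul x))
    refine Function.bijective_iff_has_inverse.mpr
      ⟨BTensor.tmul 1, fun z => ?_, fun x => one_mul x⟩
    induction z using BTensor.induction with
    | zero => rw [map_zero]; exact map_zero (BTensor.mk (1 : S))
    | tmul x y =>
      rw [BTensor.lift'_tmul]
      have h : BTensor.tmul (R := R) x (1 * y) = BTensor.tmul 1 (x * y) :=
        congrArg (fun z : BTensor R S S => op y • z) (key x)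
      rw [← h, one_mul]
    | add x y hx hy => rw [map_add, BTensor.tmul_add, hx, hy]
  · intro K F _ _ _ _ i p _ hi hp hip
    let _ : Module Sᵐᵒᵖ (BTensor R K S) := BTensor.rightModule hleft
    let _ : Module Rᵐᵒᵖ (BTensor R K S) := Module.compHom _ f.op
    let δ : K →ₗ[Rᵐᵒᵖ] BTensor R K S :=
      BTensor.tmulOne hleft (fun _ _ _ => rfl) (fun _ _ => rfl)
    obtain ⟨ρ, hρ⟩ := huniv.exists_extension (fun _ _ => rfl) hi hp hip δ
    let ρ' : BTensor R F S →+ BTensor R K S := BTensor.lift' (fun x t => op t • ρ x)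
      (fun x y t => by rw [map_add, smul_add]) (fun x t u => by rw [op_add, add_smul])
      (fun r x t => by rw [map_smul, hleft, op_mul, mul_smul]; rfl)
    refine Function.LeftInverse.injective (g := ρ') fun z => ?_
    refine DFunLike.congr_fun (BTensor.hom_ext (g := ρ'.comp (BTensor.mapLeft i))
      (h := AddMonoidHom.id _) fun k t => ?_) z
    change op t • ρ (i k) = _
    rw [hρ]
    exact congrArg (BTensor.tmul k) (one_mul t)

end Localization
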